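/- Closed-form expression for negative-order Sibson mutual information: for α < 0 and any probability mass function q_Y on Y with full support, D_α(p_{XY} ‖ p_X ⊗ q_Y) ≤ (α/(α-1)) · log Σ_y (Σ_x p_{Y|X=x}(y)^α p_X(x))^{1/α}, with equality for the optimizing q*_Y(y) proportional to (Σ_x p_{XY}(x,y)^α p_X(x)^{1-α})^{1/α}. Hence max_{q_Y} D_α(p_{XY}‖p_X ⊗ q_Y) equals the right-hand side. -/

import Mathlib

open Real Finset

/-- Closed-form expression for negative-order Sibson mutual information:
for `α < 0` and any full-support pmf `qY` on `Y`,
`D_α(p_{XY} ‖ p_X ⊗ q_Y) ≤ (α/(α-1)) · log Σ_y (Σ_x p_{Y|X=x}(y)^α p_X(x))^{1/α}`,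
with equality for the optimizer `q*_Y(y) ∝ p_Y(y)·(Σ_x p_{X|Y=y}(x)^α p_X(x)^{1-α})^{1/α}`. -/
theorem sibson_neg_order_closed_form
    {X Y : Type*} [Fintype X] [Fintype Y]
    (p : X × Y → ℝ) (hp : ∀ z, 0 < p z) (hp1 : ∑ z, p z = 1)
    (pX : X → ℝ) (hpX : ∀ x, pX x = ∑ y, p (x, y))
    (pY : Y → ℝ) (hpY : ∀ y, pY y = ∑ x, p (x, y))
    (α : ℝ) (hα : α < 0)
    (qstar : Y → ℝ)
    (hqstar : ∀ y, qstar y =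
      pY y * (∑ x, (p (x, y) / pY y) ^ α * pX x ^ (1 - α)) ^ (1 / α) /
        (∑ y', pY y' * (∑ x, (p (x, y') / pY y') ^ α * pX x ^ (1 - α)) ^ (1 / α))) :
    (∀ qY : Y → ℝ, (∀ y, 0 < qY y) → (∑ y, qY y) = 1 →
      (1 / (α - 1)) * Real.log (∑ z : X × Y, p z ^ α * (pX z.1 * qY z.2) ^ (1 - α))
        ≤ (α / (α - 1)) *
            Real.log (∑ y, (∑ x, (p (x, y) / pX x) ^ α * pX x) ^ (1 / α)))
    ∧
    (1 / (α - 1)) * Real.log (∑ z : X × Y, p z ^ α * (pX z.1 * qstar z.2) ^ (1 - α))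
      = (α / (α - 1)) *
          Real.log (∑ y, (∑ x, (p (x, y) / pX x) ^ α * pX x) ^ (1 / α)) := by
  have hne : Nonempty (X × Y) := by
    by_contra h
    rw [not_nonempty_iff] at h
    simp at hp1
  obtain ⟨x0, y0⟩ := hne
  haveI : Nonempty X := ⟨x0⟩
  haveI : Nonempty Y := ⟨y0⟩
  have hα0 : α ≠ 0 := hα.ne
  have pXpos : ∀ x, 0 < pX x := fun x => by
    rw [hpX]; exact Finset.sum_pos (fun y _ => hp _) Finset.univ_nonempty
  have pYpos : ∀ y, 0 < pY y := fun y => by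
    rw [hpY]; exact Finset.sum_pos (fun y _ => hp _) Finset.univ_nonempty
  obtain ⟨A, hA⟩ : ∃ A : Y → ℝ, ∀ y, A y = ∑ x, p (x, y) ^ α * pX x ^ (1 - α) :=
    ⟨_, fun _ => rfl⟩
  have Apos : ∀ y, 0 < A y := fun y => by
    rw [hA]
    exact Finset.sum_pos (fun x _ => mul_pos (rpow_pos_of_pos (hp _) _)
      (rpow_pos_of_pos (pXpos _) _)) Finset.univ_nonempty
  obtain ⟨g, hg⟩ : ∃ g : Y → ℝ, ∀ y, g y = A y ^ (1 / α) := ⟨_, fun _ => rfl⟩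
  have gpos : ∀ y, 0 < g y := fun y => by
    rw [hg]; exact rpow_pos_of_pos (Apos y) _
  have gA : ∀ y, g y ^ α = A y := fun y => by
    rw [hg, ← rpow_mul (Apos y).le, one_div_mul_cancel hα0, rpow_one]
  obtain ⟨G, hG⟩ : ∃ G : ℝ, G = ∑ y, g y := ⟨_, rfl⟩
  have Gpos : 0 < G := by
    rw [hG]; exact Finset.sum_pos (fun y _ => gpos y) Finset.univ_nonempty
  have hR : ∑ y, (∑ x, (p (x, y) / pX x) ^ α * pX x) ^ (1 / α) = G := by
    rw [hG]
    refine Finset.sum_congr rfl fun y _ => ?_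
    rw [hg, hA]
    congr 1
    refine Finset.sum_congr rfl fun x _ => ?_
    rw [div_rpow (hp _).le (pXpos x).le, rpow_sub (pXpos x), rpow_one]
    ring
  have hL : ∀ q : Y → ℝ, (∀ y, 0 < q y) →
      ∑ z : X × Y, p z ^ α * (pX z.1 * q z.2) ^ (1 - α) =
        ∑ y, g y ^ α * q y ^ (1 - α) := by
    intro q hq
    rw [Fintype.sum_prod_type_right]
    refine Finset.sum_congr rfl fun y _ => ?_
    rw [gA, hA, Finset.sum_mul]
    refine Finset.sum_congr rfl fun x _ => ?_
    rw [mul_rpow (pXpos x).le (hq y).le, mul_assoc]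
  have hq1 : ∀ y, pY y * (∑ x, (p (x, y) / pY y) ^ α * pX x ^ (1 - α)) ^ (1 / α) = g y := by
    intro y
    have h1 : ∑ x, (p (x, y) / pY y) ^ α * pX x ^ (1 - α) = A y / pY y ^ α := by
      rw [hA, Finset.sum_div]
      refine Finset.sum_congr rfl fun x _ => ?_
      rw [div_rpow (hp _).le (pYpos y).le]
      ring
    rw [h1, div_rpow (Apos y).le (rpow_pos_of_pos (pYpos y) _).le, ← rpow_mul (pYpos y).le,
      mul_one_div_cancel hα0, rpow_one, ← hg]
    exact mul_div_cancel₀ _ (pYpos y).ne'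
  have hqs : ∀ y, qstar y = g y / G := fun y => by
    rw [hqstar]
    simp only [hq1, ← hG]
  rw [hR]
  constructor
  · intro q hq hqsum
    rw [hL q hq]
    have key : G ^ α ≤ ∑ y, g y ^ α * q y ^ (1 - α) := by
      have J := Real.rpow_arith_mean_le_arith_mean_rpow Finset.univ (fun y => g y / G)
        (fun y => q y / (g y / G)) (fun y _ => (div_pos (gpos y) Gpos).le)
        (by rw [← Finset.sum_div, ← hG, div_self Gpos.ne'])
        (fun y _ => (div_pos (hq y) (div_pos (gpos y) Gpos)).le)
        (p := 1 - α) (by linarith)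
      have e1 : ∑ y, g y / G * (q y / (g y / G)) = 1 := by
        rw [← hqsum]
        refine Finset.sum_congr rfl fun y _ => ?_
        exact mul_div_cancel₀ _ (div_pos (gpos y) Gpos).ne'
      have e2 : ∑ y, g y / G * (q y / (g y / G)) ^ (1 - α) =
          (∑ y, g y ^ α * q y ^ (1 - α)) / G ^ α := by
        rw [Finset.sum_div]
        refine Finset.sum_congr rfl fun y _ => ?_
        have hr := div_pos (gpos y) Gpos
        rw [div_rpow (hq y).le hr.le, rpow_sub hr, rpow_one, div_rpow (gpos y).le Gpos.le]
        have := (gpos y).ne'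
        have := Gpos.ne'
        have := (rpow_pos_of_pos (gpos y) α).ne'
        have := (rpow_pos_of_pos Gpos α).ne'
        field_simp
      rw [e1, e2, one_rpow, le_div_iff₀ (rpow_pos_of_pos Gpos α), one_mul] at J
      exact J
    have hlog := Real.log_le_log (rpow_pos_of_pos Gpos α) key
    rw [log_rpow Gpos] at hlog
    have hn : 1 / (α - 1) ≤ 0 := one_div_nonpos.2 (by linarith)
    calc _ ≤ 1 / (α - 1) * (α * log G) := mul_le_mul_of_nonpos_left hlog hn
      _ = _ := by ring
  · rw [hL qstar (fun y => by rw [hqs]; exact div_pos (gpos y) Gpos)]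
    have : ∑ y, g y ^ α * qstar y ^ (1 - α) = G ^ α := by
      have e : ∀ y, g y ^ α * qstar y ^ (1 - α) = g y / G * G ^ α := by
        intro y
        rw [hqs, div_rpow (gpos y).le Gpos.le, rpow_sub (gpos y), rpow_sub Gpos, rpow_one,
          rpow_one]
        have := Gpos.ne'
        have := (rpow_pos_of_pos (gpos y) α).ne'
        have := (rpow_pos_of_pos Gpos α).ne'
        field_simp
      simp only [e]
      rw [← Finset.sum_mul, ← Finset.sum_div, ← hG, div_self Gpos.ne', one_mul]
    rw [this, log_rpow Gpos]
    ring
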